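/- arXiv:2603.17157 — 5 statements merged into one kernel-verified Lean document; each statement's English description precedes it below -/
import Mathlib

section
/- Let b ∈ ℝ, r > 0, γ ∈ ℝ with r + γ ≠ 0. For each n, let γ⁽ⁿ⁾ : Fin n → ℝ and suppose max_i |γᵢ⁽ⁿ⁾ − γ| → 0 as n → ∞. For n large enough that r + n⁻¹ Σᵢ γᵢ⁽ⁿ⁾ ≠ 0, define x̄⁽ⁿ⁾ = b / (r + n⁻¹ Σᵢ γᵢ⁽ⁿ⁾) and xᵢ⁽ⁿ⁾ = (b − γᵢ⁽ⁿ⁾ x̄⁽ⁿ⁾)/r. Then max_i |xᵢ⁽ⁿ⁾ − b/(r + γ)| → 0 as n → ∞; i.e., the Berk–Nash equilibrium actions converge to the mean-field game equilibrium x^MFG = b/(r + γ). -/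
/-- The average of finitely many reals lying within `δ` of `c` lies within `δ` of `c`. -/
theorem abs_average_sub_lt {n : ℕ} (hn : 0 < n) {f : Fin n → ℝ} {c δ : ℝ}
    (h : ∀ i, |f i - c| < δ) : |(n : ℝ)⁻¹ * ∑ i, f i - c| < δ := by
  have : NeZero n := ⟨hn.ne'⟩
  have hn' : (0 : ℝ) < n := Nat.cast_pos.2 hn
  have heq : (n : ℝ)⁻¹ * ∑ i, f i - c = (n : ℝ)⁻¹ * ∑ i, (f i - c) := by
    rw [Finset.sum_sub_distrib]
    simp [mul_sub, hn'.ne']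
  rw [heq, abs_mul, abs_of_pos (inv_pos.2 hn'), inv_mul_lt_iff₀ hn']
  calc |∑ i, (f i - c)| ≤ ∑ i, |f i - c| := Finset.abs_sum_le_sum_abs _ _
    _ < ∑ _i : Fin n, δ := Finset.sum_lt_sum_of_nonempty Finset.univ_nonempty fun i _ => h i
    _ = n * δ := by simp


/-- Mean-Field Limit: In the homogeneous game with parameters `r > 0`, `b`, and
`r + γ ≠ 0`, if the row sums `γᵢ⁽ⁿ⁾` converge to `γ` uniformly in `i`, then for all large `n`
the denominator `r + n⁻¹ Σᵢ γᵢ⁽ⁿ⁾` is nonzero and the Berk–Nash equilibrium actions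
`xᵢ⁽ⁿ⁾ = (b − γᵢ⁽ⁿ⁾ x̄⁽ⁿ⁾)/r`, with `x̄⁽ⁿ⁾ = b/(r + n⁻¹ Σᵢ γᵢ⁽ⁿ⁾)`, converge uniformly to the
mean-field game equilibrium `x^MFG = b/(r + γ)`. -/
theorem mean_field_limit (b r γ : ℝ) (hr : 0 < r) (hrγ : r + γ ≠ 0)
    (γn : (n : ℕ) → Fin n → ℝ)
    (hconv : ∀ ε > (0 : ℝ), ∃ N : ℕ, ∀ n ≥ N, ∀ i : Fin n, |γn n i - γ| < ε) :
    ∀ ε > (0 : ℝ), ∃ N : ℕ, ∀ n ≥ N,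
      r + (n : ℝ)⁻¹ * ∑ i, γn n i ≠ 0 ∧
      ∀ i : Fin n,
        |(b - γn n i * (b / (r + (n : ℝ)⁻¹ * ∑ j, γn n j))) / r - b / (r + γ)| < ε := by
  intro ε hε
  have hcont : ContinuousAt (fun p : ℝ × ℝ => (b - p.1 * (b / (r + p.2))) / r) (γ, γ) := by
    fun_prop (disch := first | exact hrγ | exact hr.ne')
  have hval : (b - γ * (b / (r + γ))) / r = b / (r + γ) := by
    field_simp
    ring
  obtain ⟨δ, hδ, hclose⟩ := Metric.continuousAt_iff.1 hcont ε hε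
  obtain ⟨N, hN⟩ := hconv (min δ |r + γ|) (lt_min hδ (abs_pos.2 hrγ))
  refine ⟨max N 1, fun n hn => ?_⟩
  have hrow := hN n (le_of_max_le_left hn)
  have havg := lt_min_iff.1 (abs_average_sub_lt (le_of_max_le_right hn) hrow)
  refine ⟨fun h0 => havg.2.ne ?_, fun i => ?_⟩
  · rw [eq_neg_of_add_eq_zero_right h0, ← neg_add', abs_neg]
  · have hdist : dist (γn n i, (n : ℝ)⁻¹ * ∑ j, γn n j) (γ, γ) < δ := by
      rw [Prod.dist_eq]
      exact max_lt (lt_min_iff.1 (hrow i)).1 havg.1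
    simpa only [hval, Real.dist_eq] using hclose hdist
end

section
/- Let R be an n×n real diagonal matrix with diagonal entries rᵢ ≥ r_min > 0, let G, G̃ be n×n real matrices with ‖G‖ < r_min and ‖G̃‖ < r_min, and let b ∈ ℝⁿ. Let x^NE and x^BN be the unique solutions of (R+G)x^NE = b and (R+G̃)x^BN = b. Then ‖x^BN − x^NE‖ ≤ (r_min − ‖G‖)⁻¹ (r_min − ‖G̃‖)⁻¹ ‖b‖ ‖G̃ − G‖. -/
/-- The action of a square matrix on Euclidean space `ℝⁿ`. -/
noncomputable def mApp {n : ℕ} (M : Matrix (Fin n) (Fin n) ℝ)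
    (x : EuclideanSpace ℝ (Fin n)) : EuclideanSpace ℝ (Fin n) :=
  Matrix.toEuclideanCLM (𝕜 := ℝ) M x

/-- The operator norm of a square matrix induced by the Euclidean norm. -/
noncomputable def opN {n : ℕ} (M : Matrix (Fin n) (Fin n) ℝ) : ℝ :=
  ‖Matrix.toEuclideanCLM (𝕜 := ℝ) M‖

theorem opN_sub_comm {n : ℕ} (A B : Matrix (Fin n) (Fin n) ℝ) :
    opN (A - B) = opN (B - A) := by
  simp only [opN, map_sub, norm_sub_rev]

theorem norm_mApp_le {n : ℕ} (M : Matrix (Fin n) (Fin n) ℝ)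
    (x : EuclideanSpace ℝ (Fin n)) : ‖mApp M x‖ ≤ opN M * ‖x‖ :=
  (Matrix.toEuclideanCLM (𝕜 := ℝ) M).le_opNorm x

theorem mul_norm_le_norm_mApp_diagonal {n : ℕ} {r : Fin n → ℝ} {c : ℝ} (hc : 0 ≤ c)
    (hr : ∀ i, c ≤ r i) (x : EuclideanSpace ℝ (Fin n)) :
    c * ‖x‖ ≤ ‖mApp (Matrix.diagonal r) x‖ := by
  have hcoord : ∀ i, mApp (Matrix.diagonal r) x i = r i * x i := fun i => by
    simp [mApp, Matrix.ofLp_toEuclideanCLM, Matrix.mulVec_diagonal]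
  refine (sq_le_sq₀ (by positivity) (norm_nonneg _)).mp ?_
  rw [mul_pow, EuclideanSpace.real_norm_sq_eq, EuclideanSpace.real_norm_sq_eq, Finset.mul_sum]
  refine Finset.sum_le_sum fun i _ => ?_
  rw [hcoord, mul_pow]
  have := hr i
  gcongr

theorem sub_opN_mul_norm_le_norm_mApp {n : ℕ} {r : Fin n → ℝ} {c : ℝ} (hc : 0 ≤ c)
    (hr : ∀ i, c ≤ r i) (G : Matrix (Fin n) (Fin n) ℝ) (x : EuclideanSpace ℝ (Fin n)) :
    (c - opN G) * ‖x‖ ≤ ‖mApp (Matrix.diagonal r + G) x‖ := by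
  have hsplit : mApp (Matrix.diagonal r) x = mApp (Matrix.diagonal r + G) x - mApp G x := by
    simp [mApp]
  have hdiag := mul_norm_le_norm_mApp_diagonal hc hr x
  have htri := norm_sub_le (mApp (Matrix.diagonal r + G) x) (mApp G x)
  rw [← hsplit] at htri
  linarith [norm_mApp_le G x]

/-- With `R = diag(r)`, `rᵢ ≥ r_min > 0`, `‖G‖ < r_min`, `‖G̃‖ < r_min`, the
solutions of `(R+G)x^NE = b` and `(R+G̃)x^BN = b` satisfy
`‖x^BN − x^NE‖ ≤ (r_min − ‖G‖)⁻¹ (r_min − ‖G̃‖)⁻¹ ‖b‖ ‖G̃ − G‖`. -/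
theorem action_gap_bound (n : ℕ) (r : Fin n → ℝ) (rmin : ℝ)
    (hrmin : 0 < rmin) (hr : ∀ i, rmin ≤ r i)
    (G Gt : Matrix (Fin n) (Fin n) ℝ) (hG : opN G < rmin) (hGt : opN Gt < rmin)
    (b xNE xBN : EuclideanSpace ℝ (Fin n))
    (hNE : mApp (Matrix.diagonal r + G) xNE = b)
    (hBN : mApp (Matrix.diagonal r + Gt) xBN = b) :
    ‖xBN - xNE‖ ≤ (rmin - opN G)⁻¹ * (rmin - opN Gt)⁻¹ * ‖b‖ * opN (Gt - G) := by
  have hgap : mApp (Matrix.diagonal r + G) (xBN - xNE) = mApp (G - Gt) xBN := by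
    have h : mApp (Matrix.diagonal r + G) xNE = mApp (Matrix.diagonal r + Gt) xBN :=
      hNE.trans hBN.symm
    simp only [mApp, map_add, map_sub, add_apply,
      sub_apply] at h ⊢
    rw [← sub_eq_zero] at h ⊢
    rw [← neg_eq_zero, ← h]
    abel
  have hx : ‖xBN‖ ≤ (rmin - opN Gt)⁻¹ * ‖b‖ := by
    rw [le_inv_mul_iff₀ (sub_pos.mpr hGt), ← hBN]
    exact sub_opN_mul_norm_le_norm_mApp hrmin.le hr Gt xBN
  have hd : ‖xBN - xNE‖ ≤ (rmin - opN G)⁻¹ * (opN (Gt - G) * ‖xBN‖) := by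
    rw [le_inv_mul_iff₀ (sub_pos.mpr hG), opN_sub_comm]
    refine (sub_opN_mul_norm_le_norm_mApp hrmin.le hr G _).trans ?_
    rw [hgap]
    exact norm_mApp_le _ _
  have hG0 : 0 ≤ (rmin - opN G)⁻¹ := inv_nonneg.mpr (sub_nonneg.mpr hG.le)
  have hN0 : 0 ≤ opN (Gt - G) := norm_nonneg _
  calc ‖xBN - xNE‖ ≤ (rmin - opN G)⁻¹ * (opN (Gt - G) * ‖xBN‖) := hd
    _ ≤ (rmin - opN G)⁻¹ * (opN (Gt - G) * ((rmin - opN Gt)⁻¹ * ‖b‖)) := by gcongr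
    _ = _ := by ring
end

section
/- Let r_min > 0 and 0 ≤ g < r_min. There exists a constant K₃ > 0, depending only on r_min, g, and a bound ρ ≥ ‖R‖, such that for every n×n real diagonal matrix R with diagonal entries rᵢ ≥ r_min and ‖R‖ ≤ ρ, every pair of n×n real matrices G, G̃ with ‖G‖ ≤ g and ‖G̃‖ ≤ g, and every b ∈ ℝⁿ, the solutions x^NE of (R+G)x = b and x^BN of (R+G̃)x = b satisfy |𝒥(x^BN) − 𝒥(x^NE)| ≤ K₃ ‖b‖² ‖G̃ − G‖, where 𝒥(x) = ½ xᵀRx + xᵀGx − bᵀx. -/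
open scoped RealInnerProductSpace

/-- The aggregate cost `𝒥(x) = ½ xᵀRx + xᵀGx − bᵀx` of the LQ network game. -/
noncomputable def aggCost {n : ℕ} (R G : Matrix (Fin n) (Fin n) ℝ)
    (b x : EuclideanSpace ℝ (Fin n)) : ℝ :=
  (1 / 2) * ⟪x, mApp R x⟫ + ⟪x, mApp G x⟫ - ⟪b, x⟫

section InnerProductSpace

variable {E : Type*} [NormedAddCommGroup E] [InnerProductSpace ℝ E]

lemma mul_norm_le_norm_apply_of_coercive {A : E →L[ℝ] E} {c : ℝ} {v : E}
    (hA : c * ‖v‖ ^ 2 ≤ ⟪v, A v⟫) : c * ‖v‖ ≤ ‖A v‖ := by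
  rcases eq_or_ne v 0 with rfl | hv
  · simp
  · have hv' : 0 < ‖v‖ := norm_pos_iff.mpr hv
    have := hA.trans (real_inner_le_norm v (A v))
    nlinarith

lemma coercive_add {A B : E →L[ℝ] E} {c g : ℝ} {v : E}
    (hA : c * ‖v‖ ^ 2 ≤ ⟪v, A v⟫) (hB : ‖B‖ ≤ g) :
    (c - g) * ‖v‖ ^ 2 ≤ ⟪v, (A + B) v⟫ := by
  have h₁ : |⟪v, B v⟫| ≤ ‖v‖ * (g * ‖v‖) :=
    (abs_real_inner_le_norm v (B v)).trans (by gcongr; exact B.le_of_opNorm_le hB v)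
  rw [add_apply, inner_add_right]
  nlinarith [neg_le_of_abs_le h₁]

lemma abs_inner_apply_self_sub_le {A : E →L[ℝ] E} {a : ℝ} (hA : ‖A‖ ≤ a) (x y : E) :
    |⟪y, A y⟫ - ⟪x, A x⟫| ≤ a * (‖y‖ + ‖x‖) * ‖y - x‖ := by
  have h : ⟪y, A y⟫ - ⟪x, A x⟫ = ⟪y, A (y - x)⟫ + ⟪y - x, A x⟫ := by
    simp only [map_sub, inner_sub_left, inner_sub_right]
    ring
  have h₁ : |⟪y, A (y - x)⟫| ≤ ‖y‖ * (a * ‖y - x‖) :=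
    (abs_real_inner_le_norm _ _).trans (by gcongr; exact A.le_of_opNorm_le hA _)
  have h₂ : |⟪y - x, A x⟫| ≤ ‖y - x‖ * (a * ‖x‖) :=
    (abs_real_inner_le_norm _ _).trans (by gcongr; exact A.le_of_opNorm_le hA _)
  rw [h]
  refine (abs_add_le _ _).trans ?_
  linarith

/-- Quantitative stability of the cost `½⟪x, A x⟫ + ⟪x, B x⟫ - ⟪b, x⟫` under replacing the
solution of `(A + B) x = b` by the solution of a perturbed equation. -/
lemma abs_cost_sub_le {A B C : E →L[ℝ] E} {c g ρ : ℝ} (hg : g < c)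
    (hA : ∀ v, c * ‖v‖ ^ 2 ≤ ⟪v, A v⟫) (hAρ : ‖A‖ ≤ ρ) (hB : ‖B‖ ≤ g) (hC : ‖C‖ ≤ g)
    {b x y : E} (hx : (A + B) x = b) (hy : (A + C) y = b) :
    |((1 / 2) * ⟪y, A y⟫ + ⟪y, B y⟫ - ⟪b, y⟫) - ((1 / 2) * ⟪x, A x⟫ + ⟪x, B x⟫ - ⟪b, x⟫)| ≤
      ((ρ + 2 * g) / (c - g) + 1) / (c - g) ^ 2 * ‖b‖ ^ 2 * ‖C - B‖ := by
  have hm : 0 < c - g := sub_pos.mpr hg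
  have hρ : 0 ≤ ρ := (norm_nonneg A).trans hAρ
  have hg0 : 0 ≤ g := (norm_nonneg B).trans hB
  have hxn : ‖x‖ ≤ ‖b‖ / (c - g) := by
    rw [le_div_iff₀' hm, ← hx]
    exact mul_norm_le_norm_apply_of_coercive (coercive_add (hA x) hB)
  have hyn : ‖y‖ ≤ ‖b‖ / (c - g) := by
    rw [le_div_iff₀' hm, ← hy]
    exact mul_norm_le_norm_apply_of_coercive (coercive_add (hA y) hC)
  have hd : (A + B) (y - x) = -((C - B) y) := by
    rw [map_sub, hx, ← hy]
    simp only [add_apply, sub_apply]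
    abel
  have hdn : ‖y - x‖ ≤ ‖C - B‖ * (‖b‖ / (c - g)) / (c - g) := by
    rw [le_div_iff₀' hm]
    refine (mul_norm_le_norm_apply_of_coercive (coercive_add (hA (y - x)) hB)).trans ?_
    rw [hd, norm_neg]
    exact (C - B).le_opNorm_of_le hyn
  have h₁ := abs_inner_apply_self_sub_le hAρ x y
  have h₂ := abs_inner_apply_self_sub_le hB x y
  have h₃ := abs_real_inner_le_norm b (y - x)
  rw [inner_sub_right] at h₃
  calc _ ≤ ((ρ / 2 + g) * (‖y‖ + ‖x‖) + ‖b‖) * ‖y - x‖ := by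
        rw [abs_le] at h₁ h₂ h₃ ⊢
        constructor <;> linarith [h₁.1, h₁.2, h₂.1, h₂.2, h₃.1, h₃.2]
    _ ≤ ((ρ / 2 + g) * (‖b‖ / (c - g) + ‖b‖ / (c - g)) + ‖b‖) *
          (‖C - B‖ * (‖b‖ / (c - g)) / (c - g)) := by gcongr
    _ = _ := by
        field_simp
        ring

end InnerProductSpace

lemma mul_norm_sq_le_inner_diagonal {n : ℕ} {r : Fin n → ℝ} {c : ℝ} (hr : ∀ i, c ≤ r i)
    (v : EuclideanSpace ℝ (Fin n)) :
    c * ‖v‖ ^ 2 ≤ ⟪v, Matrix.toEuclideanCLM (𝕜 := ℝ) (Matrix.diagonal r) v⟫ := by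
  rw [EuclideanSpace.real_norm_sq_eq, PiLp.inner_apply, Finset.mul_sum]
  refine Finset.sum_le_sum fun i _ => ?_
  have h : (Matrix.toEuclideanCLM (𝕜 := ℝ) (Matrix.diagonal r) v) i = r i * v i := by
    rw [Matrix.ofLp_toEuclideanCLM, Matrix.mulVec_diagonal]
  rw [h]
  simp only [RCLike.inner_apply, conj_trivial]
  nlinarith [mul_le_mul_of_nonneg_right (hr i) (sq_nonneg (v i))]

/-- For `0 < r_min`, `0 ≤ g < r_min`, and a bound `ρ` on `‖R‖`, there is a
constant `K₃ > 0` (depending only on `r_min, g, ρ`) such that for every diagonal `R` with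
entries `rᵢ ≥ r_min` and `‖R‖ ≤ ρ`, all `G, G̃` with `‖G‖ ≤ g`, `‖G̃‖ ≤ g`, and every `b`,
the solutions of `(R+G)x^NE = b` and `(R+G̃)x^BN = b` satisfy
`|𝒥(x^BN) − 𝒥(x^NE)| ≤ K₃ ‖b‖² ‖G̃ − G‖`. -/
theorem cost_gap_bound (rmin g ρ : ℝ) (hrmin : 0 < rmin) (hg0 : 0 ≤ g) (hg : g < rmin) :
    ∃ K₃ > (0 : ℝ), ∀ (n : ℕ) (r : Fin n → ℝ) (G Gt : Matrix (Fin n) (Fin n) ℝ)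
      (b xNE xBN : EuclideanSpace ℝ (Fin n)),
      (∀ i, rmin ≤ r i) → opN (Matrix.diagonal r) ≤ ρ → opN G ≤ g → opN Gt ≤ g →
      mApp (Matrix.diagonal r + G) xNE = b → mApp (Matrix.diagonal r + Gt) xBN = b →
      |aggCost (Matrix.diagonal r) G b xBN - aggCost (Matrix.diagonal r) G b xNE| ≤
        K₃ * ‖b‖ ^ 2 * opN (Gt - G) := by
  have hm : 0 < rmin - g := sub_pos.mpr hg
  refine ⟨((|ρ| + 2 * g) / (rmin - g) + 1) / (rmin - g) ^ 2, by positivity, ?_⟩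
  intro n r G Gt b xNE xBN hr hR hG hGt hNE hBN
  simp only [mApp, opN, map_add] at hR hG hGt hNE hBN
  simp only [aggCost, mApp, opN, map_sub]
  exact abs_cost_sub_le hg (mul_norm_sq_le_inner_diagonal hr) (hR.trans (le_abs_self ρ))
    hG hGt hNE hBN
end

section
/- Let Q be a symmetric positive semidefinite n×n real matrix, A a symmetric positive definite n×n real matrix, and v ∈ ℝⁿ with v ≠ 0. For λ > 0, Q + λA is invertible; define δ(λ) = (Q + λA)⁻¹ v and φ(λ) = δ(λ)ᵀ A δ(λ). Then φ is strictly decreasing on (0, ∞), and φ(λ) → 0 as λ → ∞. -/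
open Matrix

section Resolvent

variable {ι : Type*} [Fintype ι] {Q A : Matrix ι ι ℝ}

lemma Matrix.IsHermitian.dotProduct_mulVec_comm_real (hA : A.IsHermitian) (x y : ι → ℝ) :
    y ⬝ᵥ A *ᵥ x = x ⬝ᵥ A *ᵥ y := by
  have h : Aᵀ = A := by simpa [IsHermitian, conjTranspose_eq_transpose_of_trivial] using hA
  rw [dotProduct_mulVec, ← mulVec_transpose, h, dotProduct_comm]

/-- Solutions of the regularized systems `(Q + s A) x = v` have strictly decreasing `A`-energy
in the parameter `s`. -/
lemma energy_lt_of_regularized_eq (hQ : Q.PosSemidef) (hA : A.PosDef) {s t : ℝ} (hs : 0 < s)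
    (hst : s < t) {v x y : ι → ℝ} (hv : v ≠ 0) (hx : (Q + s • A) *ᵥ x = v)
    (hy : (Q + t • A) *ᵥ y = v) : y ⬝ᵥ A *ᵥ y < x ⬝ᵥ A *ᵥ x := by
  have hxy : x - y ≠ 0 := by
    intro h
    obtain rfl : x = y := sub_eq_zero.mp h
    have hx0 : x ≠ 0 := by
      rintro rfl
      exact hv (by simpa using hx.symm)
    have hpos := hA.dotProduct_mulVec_pos hx0
    have heq := congrArg (x ⬝ᵥ ·) (hx.trans hy.symm)
    simp only [add_mulVec, smul_mulVec, dotProduct_add, dotProduct_smul, smul_eq_mul,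
      star_trivial] at heq hpos
    nlinarith
  have hq := hQ.dotProduct_mulVec_nonneg (x - y)
  have hd := hA.dotProduct_mulVec_pos hxy
  have heq := congrArg ((x - y) ⬝ᵥ ·) (hx.trans hy.symm)
  simp only [add_mulVec, smul_mulVec, dotProduct_add, dotProduct_smul, smul_eq_mul,
    star_trivial, mulVec_sub, sub_dotProduct, dotProduct_sub] at heq hq hd
  rw [hA.isHermitian.dotProduct_mulVec_comm_real x y] at heq hd
  nlinarith [mul_pos (add_pos hs (hs.trans hst)) hd]

/-- The `A`-energy of a solution of `(Q + t A) y = A w` is at most `t⁻²` times that of `w`. -/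
lemma sq_mul_energy_le_of_regularized_eq (hQ : Q.PosSemidef) (hA : A.PosDef) {t : ℝ} (ht : 0 < t)
    {w y : ι → ℝ} (hy : (Q + t • A) *ᵥ y = A *ᵥ w) :
    t ^ 2 * (y ⬝ᵥ A *ᵥ y) ≤ w ⬝ᵥ A *ᵥ w := by
  have hq := hQ.dotProduct_mulVec_nonneg y
  have hd := hA.posSemidef.dotProduct_mulVec_nonneg (t • y - w)
  have heq := congrArg (y ⬝ᵥ ·) hy
  simp only [add_mulVec, smul_mulVec, dotProduct_add, dotProduct_smul, smul_eq_mul, smul_dotProduct,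
    star_trivial, mulVec_sub, mulVec_smul, sub_dotProduct, dotProduct_sub] at heq hq hd
  rw [hA.isHermitian.dotProduct_mulVec_comm_real y w] at hd
  nlinarith [mul_nonneg ht.le hq]

end Resolvent

/-- Let `Q` be symmetric PSD, `A` symmetric positive definite, and `v ≠ 0`.
For `λ > 0` the matrix `Q + λA` is invertible; with `δ(λ) = (Q + λA)⁻¹v` and
`φ(λ) = δ(λ)ᵀAδ(λ)`, the map `φ` is strictly decreasing on `(0, ∞)` and `φ(λ) → 0` as
`λ → ∞`. -/
theorem phi_strict_anti_tendsto_zero (n : ℕ) (Q A : Matrix (Fin n) (Fin n) ℝ)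
    (hQ : Q.PosSemidef) (hA : A.PosDef) (v : Fin n → ℝ) (hv : v ≠ 0) :
    let φ : ℝ → ℝ := fun lam =>
      ((Q + lam • A)⁻¹.mulVec v) ⬝ᵥ A.mulVec ((Q + lam • A)⁻¹.mulVec v)
    (∀ lam : ℝ, 0 < lam → IsUnit (Q + lam • A)) ∧
    StrictAntiOn φ (Set.Ioi 0) ∧
    Filter.Tendsto φ Filter.atTop (nhds 0) := by
  intro φ
  have hpd (lam : ℝ) (h : 0 < lam) : (Q + lam • A).PosDef := .posSemidef_add hQ (hA.smul h)
  have hsolve {M : Matrix (Fin n) (Fin n) ℝ} (hM : M.PosDef) : M *ᵥ (M⁻¹ *ᵥ v) = v := by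
    rw [mulVec_mulVec, mul_nonsing_inv _ ((isUnit_iff_isUnit_det M).mp hM.isUnit), one_mulVec]
  refine ⟨fun lam h => (hpd lam h).isUnit, fun s hs t ht hst => ?_, ?_⟩
  · exact energy_lt_of_regularized_eq hQ hA hs hst hv (hsolve (hpd s hs)) (hsolve (hpd t ht))
  · have hlim : Filter.Tendsto (fun t : ℝ => ((A⁻¹ *ᵥ v) ⬝ᵥ A *ᵥ (A⁻¹ *ᵥ v)) / t ^ 2)
        Filter.atTop (nhds 0) :=
      Filter.Tendsto.const_div_atTop (Filter.tendsto_pow_atTop two_ne_zero) _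
    refine squeeze_zero' (.of_forall fun t => ?_) ?_ hlim
    · exact hA.posSemidef.dotProduct_mulVec_nonneg ((Q + t • A)⁻¹ *ᵥ v)
    · filter_upwards [Filter.eventually_gt_atTop 0] with t ht
      rw [le_div_iff₀ (by positivity), mul_comm]
      exact sq_mul_energy_le_of_regularized_eq hQ hA ht
        ((hsolve (hpd t ht)).trans (hsolve hA).symm)
end

section
/- Let Q be a symmetric positive definite n×n real matrix, A a symmetric positive definite n×n real matrix, v ∈ ℝⁿ with v ≠ 0, and Γ > 0. Define δ(λ) = (Q + λA)⁻¹ v and φ(λ) = δ(λ)ᵀ A δ(λ) for λ ≥ 0. If φ(0) > Γ, then there exists a unique λ* > 0 with φ(λ*) = Γ. -/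
open Matrix

namespace Matrix

variable {ι : Type*}

theorem PosDef.add_smul {Q A : Matrix ι ι ℝ} (hQ : Q.PosDef) (hA : A.PosDef) {t : ℝ}
    (ht : 0 ≤ t) : (Q + t • A).PosDef :=
  hQ.add_posSemidef (hA.posSemidef.smul ht)

variable [Fintype ι]

theorem IsHermitian.dotProduct_mulVec_comm {A : Matrix ι ι ℝ} (hA : A.IsHermitian)
    (x y : ι → ℝ) : x ⬝ᵥ A *ᵥ y = y ⬝ᵥ A *ᵥ x := by
  have h : Aᵀ = A := by simpa [conjTranspose_eq_transpose_of_trivial] using hA.eq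
  rw [dotProduct_mulVec, dotProduct_comm, ← mulVec_transpose, h]

variable [DecidableEq ι]

theorem PosDef.mulVec_inv_mulVec {M : Matrix ι ι ℝ} (hM : M.PosDef) (v : ι → ℝ) :
    M *ᵥ (M⁻¹ *ᵥ v) = v := by
  rw [mulVec_mulVec, mul_nonsing_inv _ ((isUnit_iff_isUnit_det _).1 hM.isUnit), one_mulVec]

/-- The quadratic form of `A` at `(Q + tA)⁻¹ v`, as a function of `t`. -/
noncomputable def resolventForm (Q A : Matrix ι ι ℝ) (v : ι → ℝ) (t : ℝ) : ℝ :=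
  ((Q + t • A)⁻¹ *ᵥ v) ⬝ᵥ A *ᵥ ((Q + t • A)⁻¹ *ᵥ v)

variable {Q A : Matrix ι ι ℝ}

theorem strictAntiOn_resolventForm (hQ : Q.PosDef) (hA : A.PosDef) {v : ι → ℝ} (hv : v ≠ 0) :
    StrictAntiOn (resolventForm Q A v) (Set.Ici 0) := by
  intro s hs t ht hst
  have hM := hQ.add_smul hA (Set.mem_Ici.1 hs)
  have hx := hM.mulVec_inv_mulVec v
  have hy := (hQ.add_smul hA (Set.mem_Ici.1 ht)).mulVec_inv_mulVec v
  unfold resolventForm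
  generalize (Q + s • A)⁻¹ *ᵥ v = x at *
  generalize (Q + t • A)⁻¹ *ᵥ v = y at *
  obtain ⟨d, rfl⟩ : ∃ d, x = y + d := ⟨x - y, by simp⟩
  have hy0 : y ≠ 0 := by
    rintro rfl
    exact hv (by simpa using hy.symm)
  have hd : (Q + s • A) *ᵥ d = (t - s) • A *ᵥ y := by
    rw [← hy, mulVec_add] at hx
    simp only [add_mulVec, smul_mulVec] at hx ⊢
    rw [sub_smul]
    linear_combination hx
  have hAy := hA.dotProduct_mulVec_pos hy0
  simp only [star_trivial] at hAy
  have hd0 : d ≠ 0 := by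
    rintro rfl
    have := congrArg (y ⬝ᵥ ·) hd
    simp only [mulVec_zero, dotProduct_zero, dotProduct_smul, smul_eq_mul] at this
    exact (mul_pos (sub_pos.2 hst) hAy).ne this
  have hMd := hM.dotProduct_mulVec_pos hd0
  have hAd := hA.dotProduct_mulVec_pos hd0
  rw [hd] at hMd
  simp only [star_trivial, dotProduct_smul, smul_eq_mul] at hMd hAd
  have hdy := pos_of_mul_pos_right hMd (sub_pos.2 hst).le
  simp only [mulVec_add, add_dotProduct, dotProduct_add]
  rw [hA.isHermitian.dotProduct_mulVec_comm y d]
  linarith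

theorem continuousOn_resolventForm (hQ : Q.PosDef) (hA : A.PosDef) (v : ι → ℝ) :
    ContinuousOn (resolventForm Q A v) (Set.Ici 0) := by
  have hM : Continuous fun t : ℝ => Q + t • A := by fun_prop
  have hinv : ContinuousOn (fun t : ℝ => (Q + t • A)⁻¹) (Set.Ici 0) := by
    simp only [inv_def, Ring.inverse_eq_inv']
    exact (hM.matrix_det.continuousOn.inv₀ fun t ht => (hQ.add_smul hA ht).det_pos.ne').smul
      hM.matrix_adjugate.continuousOn
  have hform : Continuous fun B : Matrix ι ι ℝ => (B *ᵥ v) ⬝ᵥ A *ᵥ (B *ᵥ v) := by fun_prop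
  exact hform.comp_continuousOn hinv

theorem sq_mul_resolventForm_le (hQ : Q.PosDef) (hA : A.PosDef) (v : ι → ℝ) {t : ℝ}
    (ht : 0 ≤ t) : t ^ 2 * resolventForm Q A v t ≤ (A⁻¹ *ᵥ v) ⬝ᵥ v := by
  have hy := (hQ.add_smul hA ht).mulVec_inv_mulVec v
  have hw := hA.mulVec_inv_mulVec v
  unfold resolventForm
  generalize (Q + t • A)⁻¹ *ᵥ v = y at *
  generalize A⁻¹ *ᵥ v = w at *
  have hQy := hQ.posSemidef.dotProduct_mulVec_nonneg y
  have hsq := hA.posSemidef.dotProduct_mulVec_nonneg (t • y - w)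
  have hyv := congrArg (y ⬝ᵥ ·) hy
  simp only [star_trivial, mulVec_sub, mulVec_smul, sub_dotProduct, dotProduct_sub,
    smul_dotProduct, dotProduct_smul, smul_eq_mul, add_mulVec, smul_mulVec, dotProduct_add]
    at hQy hsq hyv
  rw [hA.isHermitian.dotProduct_mulVec_comm w y, hw] at hsq
  nlinarith [mul_nonneg ht hQy]

theorem exists_resolventForm_le (hQ : Q.PosDef) (hA : A.PosDef) (v : ι → ℝ) {c : ℝ}
    (hc : 0 < c) : ∃ t, 0 ≤ t ∧ resolventForm Q A v t ≤ c := by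
  have hw : 0 ≤ (A⁻¹ *ᵥ v) ⬝ᵥ v := by
    simpa [dotProduct_comm] using hA.inv.posSemidef.dotProduct_mulVec_nonneg v
  set r := (A⁻¹ *ᵥ v) ⬝ᵥ v
  have hrc : 0 ≤ r / c := by positivity
  refine ⟨1 + r / c, by positivity, ?_⟩
  refine le_of_mul_le_mul_left (a := (1 + r / c) ^ 2) ?_ (by positivity)
  refine (sq_mul_resolventForm_le hQ hA v (by positivity)).trans ?_
  calc r = r / c * c := by field_simp
    _ ≤ (1 + r / c) ^ 2 * c := by gcongr; nlinarith

end Matrix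

/-- Let `Q` and `A` be symmetric positive definite, `v ≠ 0`, `Γ > 0`, and set
`δ(λ) = (Q + λA)⁻¹v` and `φ(λ) = δ(λ)ᵀAδ(λ)`.  If `φ(0) > Γ`, then there exists a unique
`λ* > 0` with `φ(λ*) = Γ`. -/
theorem lambda_star_exists_unique (n : ℕ) (Q A : Matrix (Fin n) (Fin n) ℝ)
    (hQ : Q.PosDef) (hA : A.PosDef) (v : Fin n → ℝ) (hv : v ≠ 0) (Γ : ℝ) (hΓ : 0 < Γ) :
    let φ : ℝ → ℝ := fun lam =>
      ((Q + lam • A)⁻¹.mulVec v) ⬝ᵥ A.mulVec ((Q + lam • A)⁻¹.mulVec v)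
    φ 0 > Γ → ∃! lam : ℝ, 0 < lam ∧ φ lam = Γ := by
  intro φ hφ
  change resolventForm Q A v 0 > Γ at hφ
  change ∃! t, 0 < t ∧ resolventForm Q A v t = Γ
  obtain ⟨T, hT, hTΓ⟩ := exists_resolventForm_le hQ hA v hΓ
  obtain ⟨t, ht, htΓ⟩ := intermediate_value_Icc' hT
    ((continuousOn_resolventForm hQ hA v).mono Set.Icc_subset_Ici_self) ⟨hTΓ, hφ.le⟩
  have ht0 : 0 < t := ht.1.lt_of_ne fun h => hφ.ne' (by rw [h, htΓ])
  refine ⟨t, ⟨ht0, htΓ⟩, fun s hs => ?_⟩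
  exact (strictAntiOn_resolventForm hQ hA hv).injOn hs.1.le ht0.le (hs.2.trans htΓ.symm)
end
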